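/- Let X be an irreducible, critical multitype Galton–Watson tree with finite type space 𝒳 and bounded offspring kernel ℚ (bounded by N₀), conditioned to have exactly n vertices, and let 𝒳₀* = ⋃_{k=0}^{N₀} {k}×𝒳^k. Then for every ε > 0, lim_{n→∞} ℙ_n{ max_{(a,c)∈𝒳×𝒳₀*} | M_X(a,c) − π(a)·ℚ{c|a} | ≥ ε } = 0. -/

import Mathlib

open Filter

noncomputable section

/-- Finite rooted planar trees with vertices typed by `𝒳`. -/
inductive GWTree (𝒳 : Type) : Type where
  | node : 𝒳 → List (GWTree 𝒳) → GWTree 𝒳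

namespace GWTree

variable {𝒳 : Type}

/-- The type of the root. -/
def root : GWTree 𝒳 → 𝒳
  | node a _ => a

/-- The number of vertices. -/
def size : GWTree 𝒳 → ℕ
  | node _ ts => 1 + (ts.attach.map (fun x => size x.1)).sum
decreasing_by
  have := List.sizeOf_lt_of_mem x.2
  simp only [GWTree.node.sizeOf_spec]
  omega

/-- The product over all vertices `v` of `ℚ{C(v) | type(v)}`. -/
def wt (Q : 𝒳 → List 𝒳 → ℝ) : GWTree 𝒳 → ℝ
  | node a ts => Q a (ts.map root) * (ts.attach.map (fun x => wt Q x.1)).prod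
decreasing_by
  have := List.sizeOf_lt_of_mem x.2
  simp only [GWTree.node.sizeOf_spec]
  omega

/-- The list over all vertices `v` of the pair (type of `v`, types of the children of `v`,
ordered from left to right). -/
def data : GWTree 𝒳 → List (𝒳 × List 𝒳)
  | node a ts => (a, ts.map root) :: (ts.attach.map (fun x => data x.1)).flatten
decreasing_by
  have := List.sizeOf_lt_of_mem x.2
  simp only [GWTree.node.sizeOf_spec]
  omega

end GWTree

/-- Total weight of multitype Galton–Watson trees with exactly `n` vertices
(initial law `μ`, offspring kernel `Q`). -/
def Zn {𝒳 : Type} (μ : 𝒳 → ℝ) (Q : 𝒳 → List 𝒳 → ℝ) (n : ℕ) : ℝ :=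
  ∑' t : GWTree 𝒳, if t.size = n then μ t.root * GWTree.wt Q t else 0

open Classical in
/-- `ℙ_n(S)`: probability of the event `S` under the law of the multitype Galton–Watson tree
conditioned to have exactly `n` vertices. -/
def condPr {𝒳 : Type} (μ : 𝒳 → ℝ) (Q : 𝒳 → List 𝒳 → ℝ) (n : ℕ) (S : Set (GWTree 𝒳)) : ℝ :=
  (∑' t : GWTree 𝒳, if t.size = n ∧ t ∈ S then μ t.root * GWTree.wt Q t else 0) / Zn μ Q n

/-- The mean offspring matrix `A(a,b) = Σ_c ℚ{c|b} m(a,c)`. -/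
def gwA {𝒳 : Type} [Fintype 𝒳] [DecidableEq 𝒳] (Q : 𝒳 → List 𝒳 → ℝ) : Matrix 𝒳 𝒳 ℝ :=
  fun a b => ∑' c : List 𝒳, Q b c * (c.count a : ℝ)

/-- The empirical offspring measure `M_x` of a typed tree `x`. -/
def empOff {𝒳 : Type} [DecidableEq 𝒳] (t : GWTree 𝒳) (ac : 𝒳 × List 𝒳) : ℝ :=
  (t.data.count ac : ℝ) / (t.size : ℝ)

namespace GWTree

variable {𝒳 : Type}

open scoped ENNReal

theorem size_node (a : 𝒳) (ts : List (GWTree 𝒳)) :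
    (node a ts).size = 1 + (ts.map size).sum := by
  rw [size, List.attach_map_val (f := size)]

theorem wt_node (Q : 𝒳 → List 𝒳 → ℝ) (a : 𝒳) (ts : List (GWTree 𝒳)) :
    (node a ts).wt Q = Q a (ts.map root) * (ts.map (wt Q)).prod := by
  rw [wt, List.attach_map_val (f := (wt Q))]

theorem data_node (a : 𝒳) (ts : List (GWTree 𝒳)) :
    (node a ts).data = (a, ts.map root) :: (ts.map data).flatten := by
  rw [data, List.attach_map_val (f := data)]

/-- Structural induction on trees. -/
theorem induction_on {P : GWTree 𝒳 → Prop}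
    (h : ∀ a ts, (∀ t ∈ ts, P t) → P (node a ts)) : ∀ t, P t
  | node a ts => h a ts fun t ht => by
      have := List.sizeOf_lt_of_mem ht
      exact induction_on h t
termination_by t => sizeOf t
decreasing_by
  simp only [GWTree.node.sizeOf_spec]
  omega

theorem wt_nonneg {Q : 𝒳 → List 𝒳 → ℝ} (hQ : ∀ a c, 0 ≤ Q a c) (t : GWTree 𝒳) :
    0 ≤ t.wt Q := by
  induction t using induction_on with
  | h a ts ih =>
    rw [wt_node]
    refine mul_nonneg (hQ _ _) (List.prod_nonneg ?_)
    simpa using ih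

theorem size_pos (t : GWTree 𝒳) : 0 < t.size := by
  cases t; rw [size_node]; omega

/-- A tree is a root type together with a list of subtrees. -/
def equivProd : GWTree 𝒳 ≃ 𝒳 × List (GWTree 𝒳) where
  toFun | node a ts => (a, ts)
  invFun p := node p.1 p.2
  left_inv t := by cases t; rfl
  right_inv _ := rfl

theorem ofReal_list_prod {α : Type*} {f : α → ℝ} (hf : ∀ x, 0 ≤ f x) (l : List α) :
    ENNReal.ofReal (l.map f).prod = (l.map fun x => ENNReal.ofReal (f x)).prod := by
  induction l with
  | nil => simp
  | cons x l ih => simp [ENNReal.ofReal_mul (hf x), ih]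

theorem tsum_list {α : Type*} (f : List α → ℝ≥0∞) :
    ∑' l, f l = f [] + ∑' x, ∑' l, f (x :: l) := by
  let e : Unit ⊕ (α × List α) ≃ List α :=
    { toFun := fun o => o.elim (fun _ => []) fun p => p.1 :: p.2
      invFun := fun l => match l with
        | [] => .inl ()
        | x :: l => .inr (x, l)
      left_inv := fun o => by rcases o with _ | ⟨x, l⟩ <;> rfl
      right_inv := fun l => by cases l <;> rfl }
  rw [← e.tsum_eq, Summable.tsum_sum ENNReal.summable ENNReal.summable, tsum_fintype,
    ENNReal.tsum_prod']
  simp [e]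

theorem tsum_eq (f : GWTree 𝒳 → ℝ≥0∞) : ∑' t, f t = ∑' a, ∑' ts, f (node a ts) := by
  rw [← equivProd.symm.tsum_eq, ENNReal.tsum_prod']
  rfl

variable [DecidableEq 𝒳]

/-- Total mass given by `ψ` to the trees with root type `a`. -/
def rootSum (ψ : GWTree 𝒳 → ℝ≥0∞) (a : 𝒳) : ℝ≥0∞ :=
  ∑' t : GWTree 𝒳, if t.root = a then ψ t else 0

theorem rootSum_eq (ψ : GWTree 𝒳 → ℝ≥0∞) (a : 𝒳) :
    rootSum ψ a = ∑' ts, ψ (node a ts) := by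
  rw [rootSum, tsum_eq, tsum_eq_single a]
  · simp [root]
  · intro b hb
    simp [root, hb]

theorem tsum_forest (ψ : GWTree 𝒳 → ℝ≥0∞) (c : List 𝒳) :
    (∑' ts : List (GWTree 𝒳), if ts.map root = c then (ts.map ψ).prod else 0)
      = (c.map (rootSum ψ)).prod := by
  induction c with
  | nil =>
    rw [tsum_list]
    simp
  | cons b c ih =>
    rw [tsum_list]
    have h : ∀ (t : GWTree 𝒳) (ts : List (GWTree 𝒳)),
        (if (t :: ts).map root = b :: c then ((t :: ts).map ψ).prod else 0)
          = (if t.root = b then ψ t else 0) *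
            (if ts.map root = c then (ts.map ψ).prod else 0) := by
      intro t ts
      by_cases h1 : t.root = b <;> by_cases h2 : ts.map root = c <;> simp [h1, h2]
    simp only [h, ENNReal.tsum_mul_left, ih, ENNReal.tsum_mul_right]
    simp [rootSum]

theorem tsum_fiber {α β : Type*} [DecidableEq β] (g : α → β) (f : α → ℝ≥0∞) :
    ∑' x, f x = ∑' y, ∑' x, if g x = y then f x else 0 := by
  rw [ENNReal.tsum_comm]
  refine tsum_congr fun x => ?_
  rw [tsum_eq_single (g x)]
  · simp
  · intro y hy
    simp [Ne.symm hy]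

theorem tsum_forest_mul (φ : List 𝒳 → ℝ≥0∞) (ψ : GWTree 𝒳 → ℝ≥0∞) :
    (∑' ts : List (GWTree 𝒳), φ (ts.map root) * (ts.map ψ).prod)
      = ∑' c, φ c * (c.map (rootSum ψ)).prod := by
  rw [tsum_fiber (fun ts : List (GWTree 𝒳) => ts.map root)]
  refine tsum_congr fun c => ?_
  rw [← tsum_forest, ← ENNReal.tsum_mul_left]
  refine tsum_congr fun ts => ?_
  by_cases h : ts.map root = c
  · simp [h]
  · simp [h]

/-- Weights with values in `ℝ≥0∞`. -/
def ewt (Q : 𝒳 → List 𝒳 → ℝ) (t : GWTree 𝒳) : ℝ≥0∞ := ENNReal.ofReal (t.wt Q)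

omit [DecidableEq 𝒳] in
theorem ewt_node {Q : 𝒳 → List 𝒳 → ℝ} (hQ : ∀ a c, 0 ≤ Q a c) (a : 𝒳)
    (ts : List (GWTree 𝒳)) :
    (node a ts).ewt Q = ENNReal.ofReal (Q a (ts.map root)) * (ts.map (ewt Q)).prod := by
  rw [ewt, wt_node, ENNReal.ofReal_mul (hQ _ _), ofReal_list_prod (wt_nonneg hQ)]
  rfl

theorem rootSum_ewt {Q : 𝒳 → List 𝒳 → ℝ} (hQ : ∀ a c, 0 ≤ Q a c) (a : 𝒳) :
    rootSum (ewt Q) a =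
      ∑' c, ENNReal.ofReal (Q a c) * (c.map (rootSum (ewt Q))).prod := by
  rw [rootSum_eq, ← tsum_forest_mul]
  exact tsum_congr fun ts => ewt_node hQ a ts

theorem rootSum_mono {ψ ψ' : GWTree 𝒳 → ℝ≥0∞} (h : ∀ t, ψ t ≤ ψ' t) (a : 𝒳) :
    rootSum ψ a ≤ rootSum ψ' a := by
  refine ENNReal.tsum_le_tsum fun t => ?_
  split_ifs
  · exact h t
  · exact le_rfl

theorem prod_map_ite_ne_zero {α : Type*} (p : α → Prop) [DecidablePred p] (f : α → ℝ≥0∞)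
    (l : List α) (hl : ∀ x ∈ l, p x) :
    (l.map f).prod = (l.map fun x => if p x then f x else 0).prod := by
  congr 1
  refine List.map_congr_left fun x hx => ?_
  simp [hl x hx]

omit [DecidableEq 𝒳] in
theorem size_le_sum_of_mem {t : GWTree 𝒳} {ts : List (GWTree 𝒳)} (h : t ∈ ts) :
    t.size ≤ (ts.map size).sum :=
  List.single_le_sum (by simp) _ (List.mem_map_of_mem h)

theorem list_prod_le_one {l : List ℝ≥0∞} (h : ∀ x ∈ l, x ≤ 1) : l.prod ≤ 1 := by
  induction l with
  | nil => simp
  | cons x l ih =>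
    simp only [List.mem_cons, forall_eq_or_imp] at h
    rw [List.prod_cons]
    exact mul_le_one' h.1 (ih h.2)

theorem rootSum_trunc_le_one {Q : 𝒳 → List 𝒳 → ℝ} (hQ : ∀ a c, 0 ≤ Q a c)
    (hQ1 : ∀ a, ∑' c, ENNReal.ofReal (Q a c) ≤ 1) (n : ℕ) (a : 𝒳) :
    rootSum (fun t => if t.size ≤ n then ewt Q t else 0) a ≤ 1 := by
  induction n generalizing a with
  | zero =>
    have : ∀ t : GWTree 𝒳, ¬ t.size ≤ 0 := fun t => by have := t.size_pos; omega
    simp [rootSum, this]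
  | succ n ih =>
    rw [rootSum_eq]
    set ψ : GWTree 𝒳 → ℝ≥0∞ := fun t => if t.size ≤ n then ewt Q t else 0
    calc _ ≤ ∑' ts : List (GWTree 𝒳),
          ENNReal.ofReal (Q a (ts.map root)) * (ts.map ψ).prod := by
          refine ENNReal.tsum_le_tsum fun ts => ?_
          split_ifs with h
          · rw [ewt_node hQ]
            rw [size_node] at h
            rw [prod_map_ite_ne_zero (fun t => t.size ≤ n) (ewt Q) ts
              (fun t ht => by have := size_le_sum_of_mem ht; omega)]
          · exact zero_le
      _ = ∑' c, ENNReal.ofReal (Q a c) * (c.map (rootSum ψ)).prod :=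
          tsum_forest_mul (fun c => ENNReal.ofReal (Q a c)) ψ
      _ ≤ ∑' c, ENNReal.ofReal (Q a c) := by
          refine ENNReal.tsum_le_tsum fun c => ?_
          refine mul_le_of_le_one_right' (list_prod_le_one ?_)
          simpa using fun b _ => ih b
      _ ≤ 1 := hQ1 a

theorem rootSum_le_one {Q : 𝒳 → List 𝒳 → ℝ} (hQ : ∀ a c, 0 ≤ Q a c)
    (hQ1 : ∀ a, ∑' c, ENNReal.ofReal (Q a c) ≤ 1) (a : 𝒳) :
    rootSum (ewt Q) a ≤ 1 := by
  rw [rootSum, ENNReal.tsum_eq_iSup_sum]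
  refine iSup_le fun s => ?_
  refine le_trans ?_ (rootSum_trunc_le_one hQ hQ1 (s.sup size) a)
  refine le_trans (Finset.sum_le_sum fun t ht => ?_) (ENNReal.sum_le_tsum s)
  simp [Finset.le_sup (f := size) ht]

theorem tsum_ewt_le_card [Fintype 𝒳] {Q : 𝒳 → List 𝒳 → ℝ} (hQ : ∀ a c, 0 ≤ Q a c)
    (hQ1 : ∀ a, ∑' c, ENNReal.ofReal (Q a c) ≤ 1) :
    ∑' t, ewt Q t ≤ Fintype.card 𝒳 := by
  rw [tsum_fiber root, tsum_fintype]
  refine (Finset.sum_le_sum fun a _ => rootSum_le_one hQ hQ1 a).trans ?_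
  simp

theorem summable_wt [Fintype 𝒳] {Q : 𝒳 → List 𝒳 → ℝ} (hQ : ∀ a c, 0 ≤ Q a c)
    (hQ1 : ∀ a, ∑' c, ENNReal.ofReal (Q a c) ≤ 1) : Summable (wt Q) := by
  have h : ∑' t, ewt Q t ≠ ∞ :=
    ((tsum_ewt_le_card hQ hQ1).trans_lt (ENNReal.natCast_lt_top _)).ne
  have := ENNReal.summable_toReal h
  exact this.congr fun t => ENNReal.toReal_ofReal (wt_nonneg hQ t)

theorem tsum_wt_le_card [Fintype 𝒳] {Q : 𝒳 → List 𝒳 → ℝ} (hQ : ∀ a c, 0 ≤ Q a c)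
    (hQ1 : ∀ a, ∑' c, ENNReal.ofReal (Q a c) ≤ 1) :
    ∑' t, wt Q t ≤ Fintype.card 𝒳 := by
  have h := tsum_ewt_le_card hQ hQ1
  simp only [ewt] at h
  rw [← ENNReal.ofReal_tsum_of_nonneg (wt_nonneg hQ) (summable_wt hQ hQ1),
    ENNReal.ofReal_le_iff_le_toReal (ENNReal.natCast_ne_top _)] at h
  simpa using h

/-- If almost every tree is finite, the expected sizes satisfy the first-moment recursion. -/
theorem tsum_forest_size {ψ : GWTree 𝒳 → ℝ≥0∞} (hψ : ∀ a, rootSum ψ a = 1) (c : List 𝒳) :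
    (∑' ts : List (GWTree 𝒳),
        if ts.map root = c then ((ts.map size).sum : ℕ) * (ts.map ψ).prod else 0)
      = (c.map (rootSum fun t => t.size * ψ t)).sum := by
  induction c with
  | nil =>
    rw [tsum_list]
    simp
  | cons b c ih =>
    rw [tsum_list]
    have h : ∀ (t : GWTree 𝒳) (ts : List (GWTree 𝒳)),
        (if (t :: ts).map root = b :: c then
            ((((t :: ts).map size).sum : ℕ) : ℝ≥0∞) * ((t :: ts).map ψ).prod else 0)
          = (if t.root = b then t.size * ψ t else 0) *
              (if ts.map root = c then (ts.map ψ).prod else 0) +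
            (if t.root = b then ψ t else 0) *
              (if ts.map root = c then ((ts.map size).sum : ℕ) * (ts.map ψ).prod else 0) := by
      intro t ts
      by_cases h1 : t.root = b <;> by_cases h2 : ts.map root = c <;> simp [h1, h2]
      ring
    have h1 : (c.map (rootSum ψ)).prod = 1 := List.prod_eq_one (by simp [hψ])
    have h2 := hψ b
    rw [rootSum] at h2
    simp only [h, ENNReal.tsum_add, ENNReal.tsum_mul_left, ih, ENNReal.tsum_mul_right,
      tsum_forest, h1, h2]
    simp [rootSum]

theorem rootSum_size {Q : 𝒳 → List 𝒳 → ℝ} (hQ : ∀ a c, 0 ≤ Q a c)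
    (h1 : ∀ a, rootSum (ewt Q) a = 1) (a : 𝒳) :
    rootSum (fun t => t.size * ewt Q t) a =
      1 + ∑' c, ENNReal.ofReal (Q a c) *
        (c.map (rootSum fun t => t.size * ewt Q t)).sum := by
  rw [← h1 a, rootSum_eq, rootSum_eq]
  have : ∀ ts, ((node a ts).size : ℝ≥0∞) * (node a ts).ewt Q = (node a ts).ewt Q +
      ENNReal.ofReal (Q a (ts.map root)) *
        (((ts.map size).sum : ℕ) * (ts.map (ewt Q)).prod) := by
    intro ts
    rw [size_node, ewt_node hQ]
    push_cast
    ring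
  simp only [this, ENNReal.tsum_add]
  congr 1
  rw [tsum_fiber (fun ts : List (GWTree 𝒳) => ts.map root)]
  refine tsum_congr fun c => ?_
  rw [← tsum_forest_size h1, ← ENNReal.tsum_mul_left]
  refine tsum_congr fun ts => ?_
  by_cases h : ts.map root = c <;> simp [h]

end GWTree

open scoped Matrix

namespace Matrix

variable {ι : Type*} [Fintype ι] [DecidableEq ι]

theorem pow_mulVec_of_fixed {B : Matrix ι ι ℝ} {v : ι → ℝ} (hv : B *ᵥ v = v) (k : ℕ) :
    B ^ k *ᵥ v = v := by
  induction k with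
  | zero => simp
  | succ k ih => rw [pow_succ, ← mulVec_mulVec, hv, ih]

theorem fixed_pos_of_irreducible {B : Matrix ι ι ℝ} (hB : ∀ a b, 0 ≤ B a b)
    (hirr : ∀ a b, ∃ k : ℕ, 0 < k ∧ 0 < (B ^ k) a b) {v : ι → ℝ} (hv0 : ∀ a, 0 ≤ v a)
    (hv : B *ᵥ v = v) {b : ι} (hb : 0 < v b) (a : ι) : 0 < v a := by
  obtain ⟨k, -, hk⟩ := hirr a b
  rw [← pow_mulVec_of_fixed hv k]
  refine (mul_pos hk hb).trans_le ?_
  exact Finset.single_le_sum (f := fun c => (B ^ k) a c * v c)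
    (fun c _ => mul_nonneg (pow_apply_nonneg hB k a c) (hv0 c)) (Finset.mem_univ b)

theorem fixed_unique_of_irreducible [Nonempty ι] {B : Matrix ι ι ℝ} (hB : ∀ a b, 0 ≤ B a b)
    (hirr : ∀ a b, ∃ k : ℕ, 0 < k ∧ 0 < (B ^ k) a b) {p v : ι → ℝ} (hp0 : ∀ a, 0 < p a)
    (hp : B *ᵥ p = p) (hv : B *ᵥ v = v) : ∃ r : ℝ, v = r • p := by
  obtain ⟨a₀, ha₀⟩ := Finite.exists_min fun a => v a / p a
  refine ⟨v a₀ / p a₀, ?_⟩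
  set r := v a₀ / p a₀ with hr
  have hw0 : ∀ a, 0 ≤ (v - r • p) a := fun a => by
    have := (le_div_iff₀ (hp0 a)).1 (ha₀ a)
    simpa using this
  have hw : B *ᵥ (v - r • p) = v - r • p := by
    rw [mulVec_sub, mulVec_smul, hp, hv]
  have hz : (v - r • p) a₀ = 0 := by
    have := (hp0 a₀).ne'
    simp [hr, this]
  funext a
  by_contra hne
  have hpos : 0 < (v - r • p) a :=
    lt_of_le_of_ne (hw0 a) fun h => hne (by
      simp only [Pi.sub_apply] at h
      linarith)
  exact (fixed_pos_of_irreducible hB hirr hw0 hw hpos a₀).ne' hz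

theorem transpose_irreducible {B : Matrix ι ι ℝ}
    (hirr : ∀ a b, ∃ k : ℕ, 0 < k ∧ 0 < (B ^ k) a b) (a b : ι) :
    ∃ k : ℕ, 0 < k ∧ 0 < (Bᵀ ^ k) a b := by
  obtain ⟨k, hk, h⟩ := hirr b a
  exact ⟨k, hk, by rwa [← transpose_pow, transpose_apply]⟩

/-- Solvability of the Poisson equation for an irreducible critical matrix. -/
theorem exists_poisson_solution [Nonempty ι] {B : Matrix ι ι ℝ} (hB : ∀ a b, 0 ≤ B a b)
    (hirr : ∀ a b, ∃ k : ℕ, 0 < k ∧ 0 < (B ^ k) a b) {p : ι → ℝ} (hp0 : ∀ a, 0 < p a)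
    (hp : B *ᵥ p = p) {g : ι → ℝ} (hg : p ⬝ᵥ g = 0) :
    ∃ h : ι → ℝ, g = h - Bᵀ *ᵥ h := by
  by_contra! hne
  have hg' : g ∉ LinearMap.range (Matrix.toLin' (1 - Bᵀ)) := by
    rintro ⟨h, hh⟩
    refine hne h ?_
    rw [← hh, toLin'_apply, sub_mulVec, one_mulVec]
  obtain ⟨φ, hφg, hφ⟩ := Submodule.exists_le_ker_of_notMem hg'
  set v : ι → ℝ := fun a => φ (Pi.single a 1) with hv
  have hφv : ∀ x : ι → ℝ, φ x = v ⬝ᵥ x := fun x => by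
    rw [LinearMap.pi_apply_eq_sum_univ φ x]
    refine Finset.sum_congr rfl fun a _ => ?_
    simp [hv, mul_comm]
    left
    congr 1
    ext i
    simp [Pi.single_apply, eq_comm]
  have hfix : B *ᵥ v = v := by
    rw [← sub_eq_zero]
    refine dotProduct_eq_zero _ fun x => ?_
    have h0 : φ (Matrix.toLin' (1 - Bᵀ) x) = 0 := hφ ⟨x, rfl⟩
    rw [hφv, toLin'_apply, sub_mulVec, one_mulVec, dotProduct_sub, dotProduct_mulVec,
      vecMul_transpose] at h0
    rw [sub_dotProduct]
    linarith
  obtain ⟨r, hr⟩ := fixed_unique_of_irreducible hB hirr hp0 hp hfix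
  apply hφg
  rw [hφv, hr, smul_dotProduct, hg, smul_zero]

end Matrix

theorem List.sum_map_eq_sum_count {ι R : Type*} [Fintype ι] [DecidableEq ι] [CommSemiring R]
    (h : ι → R) (c : List ι) : (c.map h).sum = ∑ b, (c.count b : R) * h b := by
  induction c with
  | nil => simp
  | cons x c ih =>
    simp only [List.map_cons, List.sum_cons, ih, List.count_cons, Nat.cast_add, add_mul,
      Finset.sum_add_distrib]
    rw [add_comm]
    simp

/-- A bounded, irreducible and critical offspring kernel, with its Perron–Frobenius vector. -/
structure IsCriticalKernel {𝒳 : Type} [Fintype 𝒳] [DecidableEq 𝒳] (Q : 𝒳 → List 𝒳 → ℝ)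
    (N₀ : ℕ) (π : 𝒳 → ℝ) : Prop where
  nonneg : ∀ a c, 0 ≤ Q a c
  tsum_one : ∀ a, ∑' c : List 𝒳, Q a c = 1
  bdd : ∀ a (c : List 𝒳), N₀ < c.length → Q a c = 0
  irr : ∀ a b, ∃ k : ℕ, 0 < k ∧ 0 < (gwA Q ^ k) a b
  left_nonneg : ∀ a, 0 ≤ π a
  left_sum : ∑ a, π a = 1
  crit : ∀ a, ∑ b, gwA Q a b * π b = π a

namespace IsCriticalKernel

variable {𝒳 : Type} [Fintype 𝒳] [DecidableEq 𝒳] {Q : 𝒳 → List 𝒳 → ℝ} {N₀ : ℕ} {π : 𝒳 → ℝ}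

open GWTree
open scoped ENNReal

/-- The finite set of lists of length at most `N`. -/
def lists (𝒳 : Type) [Fintype 𝒳] (N : ℕ) : Finset (List 𝒳) :=
  (List.finite_length_le 𝒳 N).toFinset

omit [DecidableEq 𝒳] in
theorem mem_lists {N : ℕ} {c : List 𝒳} : c ∈ lists 𝒳 N ↔ c.length ≤ N := by
  simp [lists]

theorem eq_zero_of_notMem (H : IsCriticalKernel Q N₀ π) {c : List 𝒳} (hc : c ∉ lists 𝒳 N₀)
    (a : 𝒳) : Q a c = 0 :=
  H.bdd a c (by simpa [mem_lists] using hc)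

theorem sum_one (H : IsCriticalKernel Q N₀ π) (a : 𝒳) : ∑ c ∈ lists 𝒳 N₀, Q a c = 1 := by
  rw [← H.tsum_one a, tsum_eq_sum fun c hc => H.eq_zero_of_notMem hc a]

theorem gwA_eq (H : IsCriticalKernel Q N₀ π) (a b : 𝒳) :
    gwA Q a b = ∑ c ∈ lists 𝒳 N₀, Q b c * (c.count a : ℝ) :=
  tsum_eq_sum fun c hc => by rw [H.eq_zero_of_notMem hc, zero_mul]

theorem gwA_nonneg (H : IsCriticalKernel Q N₀ π) (a b : 𝒳) : 0 ≤ gwA Q a b := by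
  rw [H.gwA_eq]
  exact Finset.sum_nonneg fun c _ => mul_nonneg (H.nonneg _ _) (Nat.cast_nonneg _)

theorem mulVec_left (H : IsCriticalKernel Q N₀ π) : gwA Q *ᵥ π = π :=
  funext H.crit

theorem left_pos (H : IsCriticalKernel Q N₀ π) (a : 𝒳) : 0 < π a := by
  obtain ⟨b, -, hb⟩ : ∃ b ∈ Finset.univ, 0 < π b := by
    by_contra! h
    have := Finset.sum_nonpos h
    rw [H.left_sum] at this
    norm_num at this
  exact Matrix.fixed_pos_of_irreducible H.gwA_nonneg H.irr H.left_nonneg H.mulVec_left hb a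

theorem mean_sum (H : IsCriticalKernel Q N₀ π) (h : 𝒳 → ℝ) (a : 𝒳) :
    ∑ c ∈ lists 𝒳 N₀, Q a c * (c.map h).sum = ((gwA Q)ᵀ *ᵥ h) a := by
  simp only [List.sum_map_eq_sum_count, Matrix.mulVec, dotProduct, Matrix.transpose_apply,
    H.gwA_eq, Finset.sum_mul, Finset.mul_sum]
  rw [Finset.sum_comm]
  simp only [mul_assoc]

theorem left_dotProduct (H : IsCriticalKernel Q N₀ π) (h : 𝒳 → ℝ) :
    π ⬝ᵥ ((gwA Q)ᵀ *ᵥ h) = π ⬝ᵥ h := by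
  rw [Matrix.dotProduct_mulVec, Matrix.vecMul_transpose, H.mulVec_left]

theorem tsum_ofReal (H : IsCriticalKernel Q N₀ π) (a : 𝒳) :
    ∑' c, ENNReal.ofReal (Q a c) = 1 := by
  rw [tsum_eq_sum fun c hc => by rw [H.eq_zero_of_notMem hc, ENNReal.ofReal_zero],
    ← ENNReal.ofReal_sum_of_nonneg fun c _ => H.nonneg a c, H.sum_one, ENNReal.ofReal_one]

omit [Fintype 𝒳] [DecidableEq 𝒳] in
theorem one_sub_sum_le_prod {s : 𝒳 → ℝ} (h0 : ∀ a, 0 ≤ s a) (h1 : ∀ a, s a ≤ 1)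
    (c : List 𝒳) : 1 - (c.map s).sum ≤ (c.map fun b => 1 - s b).prod ∧
      0 ≤ (c.map fun b => 1 - s b).prod ∧ (c.map fun b => 1 - s b).prod ≤ 1 := by
  induction c with
  | nil => simp
  | cons b c ih =>
    obtain ⟨i1, i2, i3⟩ := ih
    simp only [List.map_cons, List.sum_cons, List.prod_cons]
    have := h0 b
    have := h1 b
    refine ⟨by nlinarith, by nlinarith, by nlinarith⟩

/-- A critical kernel that allows a leaf also allows a branching. -/
theorem exists_branching (H : IsCriticalKernel Q N₀ π) {a₀ : 𝒳} (h₀ : 0 < Q a₀ []) :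
    ∃ a b₁ b₂ l, 0 < Q a (b₁ :: b₂ :: l) := by
  by_contra! hne
  have hlen : ∀ a c, Q a c * (c.map fun _ => (1 : ℝ)).sum ≤
      Q a c - if c = [] then Q a c else 0 := by
    rintro a (_ | ⟨b₁, _ | ⟨b₂, l⟩⟩)
    · simp
    · simp
    · have := le_antisymm (hne a b₁ b₂ l) (H.nonneg _ _)
      simp [this]
  have hmean : ∀ a, ((gwA Q)ᵀ *ᵥ fun _ => (1 : ℝ)) a ≤ 1 - Q a [] := fun a => by
    rw [← H.mean_sum]
    refine (Finset.sum_le_sum fun c _ => hlen a c).trans ?_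
    rw [Finset.sum_sub_distrib, H.sum_one, Finset.sum_ite_eq',
      if_pos (mem_lists.2 (Nat.zero_le _))]
  have h1 := H.left_dotProduct fun _ => (1 : ℝ)
  have h2 : π ⬝ᵥ ((gwA Q)ᵀ *ᵥ fun _ => (1 : ℝ)) ≤ ∑ a, π a * (1 - Q a []) :=
    Finset.sum_le_sum fun a _ => mul_le_mul_of_nonneg_left (hmean a) (H.left_nonneg a)
  have h3 : ∑ a, π a * (1 - Q a []) < ∑ a, π a * 1 :=
    Finset.sum_lt_sum
      (fun a _ => mul_le_mul_of_nonneg_left (by linarith [H.nonneg a []]) (H.left_nonneg a))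
      ⟨a₀, Finset.mem_univ _, mul_lt_mul_of_pos_left (by linarith) (H.left_pos a₀)⟩
  rw [h1] at h2
  exact absurd h3 (not_lt.2 h2)

/-- The extinction equation of a critical branching process has only the trivial solution. -/
theorem extinction_eq_zero (H : IsCriticalKernel Q N₀ π) {a₀ : 𝒳} (h₀ : 0 < Q a₀ [])
    {s : 𝒳 → ℝ} (s0 : ∀ a, 0 ≤ s a) (s1 : ∀ a, s a ≤ 1)
    (hs : ∀ a, 1 - s a = ∑ c ∈ lists 𝒳 N₀, Q a c * (c.map fun b => 1 - s b).prod) (a : 𝒳) :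
    s a = 0 := by
  have hsA : ∀ a, s a = ∑ c ∈ lists 𝒳 N₀, Q a c * (1 - (c.map fun b => 1 - s b).prod) := by
    intro a
    simp only [mul_sub, mul_one, Finset.sum_sub_distrib, H.sum_one, ← hs]
    ring
  have hterm : ∀ a c, Q a c * (1 - (c.map fun b => 1 - s b).prod) ≤ Q a c * (c.map s).sum :=
    fun a c => mul_le_mul_of_nonneg_left (by linarith [(one_sub_sum_le_prod s0 s1 c).1])
      (H.nonneg a c)
  have hle : ∀ a, s a ≤ ((gwA Q)ᵀ *ᵥ s) a := fun a => by
    rw [← H.mean_sum, hsA a]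
    exact Finset.sum_le_sum fun c _ => hterm a c
  have heq : (gwA Q)ᵀ *ᵥ s = s := by
    have h := (Finset.sum_eq_sum_iff_of_le (s := Finset.univ)
      (f := fun a => π a * s a) (g := fun a => π a * ((gwA Q)ᵀ *ᵥ s) a)
      fun a _ => mul_le_mul_of_nonneg_left (hle a) (H.left_nonneg a)).1
      (H.left_dotProduct s).symm
    funext a
    exact (mul_left_cancel₀ (H.left_pos a).ne' (h a (Finset.mem_univ a))).symm
  by_contra hne
  have hpos : ∀ b, 0 < s b := Matrix.fixed_pos_of_irreducible
    (fun a b => H.gwA_nonneg b a) (Matrix.transpose_irreducible H.irr) s0 heq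
    (lt_of_le_of_ne (s0 a) (Ne.symm hne))
  obtain ⟨a', b₁, b₂, l, hb⟩ := H.exists_branching h₀
  have hmem : b₁ :: b₂ :: l ∈ lists 𝒳 N₀ := by
    by_contra h
    exact hb.ne' (H.eq_zero_of_notMem h a')
  have hlt : s a' < ((gwA Q)ᵀ *ᵥ s) a' := by
    rw [← H.mean_sum, hsA a']
    refine Finset.sum_lt_sum (fun c _ => hterm a' c) ⟨_, hmem, ?_⟩
    refine mul_lt_mul_of_pos_left ?_ hb
    obtain ⟨i1, i2, i3⟩ := one_sub_sum_le_prod s0 s1 l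
    simp only [List.map_cons, List.sum_cons, List.prod_cons]
    have p1 := hpos b₁
    have p2 := hpos b₂
    have p3 := s1 b₂
    set P := (l.map fun b => 1 - s b).prod
    have hu : (1 - s b₂) * P < 1 := by nlinarith
    nlinarith
  exact hlt.ne (congrFun heq a').symm

theorem rootSum_eq_one (H : IsCriticalKernel Q N₀ π) {a₀ : 𝒳} (h₀ : 0 < Q a₀ []) (a : 𝒳) :
    rootSum (ewt Q) a = 1 := by
  have hle : ∀ a, rootSum (ewt Q) a ≤ 1 :=
    rootSum_le_one H.nonneg fun a => (H.tsum_ofReal a).le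
  have hne : ∀ a, rootSum (ewt Q) a ≠ ∞ := fun a => ((hle a).trans_lt ENNReal.one_lt_top).ne
  set q : 𝒳 → ℝ := fun a => (rootSum (ewt Q) a).toReal with hq
  have hq0 : ∀ a, 0 ≤ q a := fun a => ENNReal.toReal_nonneg
  have hq1 : ∀ a, q a ≤ 1 := fun a => by
    simpa using ENNReal.toReal_mono ENNReal.one_ne_top (hle a)
  have hqe : ∀ a, rootSum (ewt Q) a = ENNReal.ofReal (q a) := fun a =>
    (ENNReal.ofReal_toReal (hne a)).symm
  have hprod : ∀ c : List 𝒳, 0 ≤ (c.map q).prod := fun c =>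
    List.prod_nonneg (by simpa using fun a _ => hq0 a)
  have hrec : ∀ a, q a = ∑ c ∈ lists 𝒳 N₀, Q a c * (c.map q).prod := fun a => by
    have h := rootSum_ewt H.nonneg a
    rw [funext hqe, tsum_eq_sum fun c hc => by
      rw [H.eq_zero_of_notMem hc, ENNReal.ofReal_zero, zero_mul]] at h
    simp only [← ofReal_list_prod hq0, ← ENNReal.ofReal_mul (H.nonneg _ _)] at h
    rw [← ENNReal.ofReal_sum_of_nonneg fun c _ => mul_nonneg (H.nonneg a c) (hprod c)] at h
    exact (ENNReal.ofReal_eq_ofReal_iff (hq0 a)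
      (Finset.sum_nonneg fun c _ => mul_nonneg (H.nonneg a c) (hprod c))).1 h
  have hz := H.extinction_eq_zero h₀ (s := fun a => 1 - q a) (fun a => by linarith [hq1 a])
    (fun a => by linarith [hq0 a]) (fun a => by simpa using hrec a) a
  rw [hqe, show q a = 1 by linarith, ENNReal.ofReal_one]

/-- The expected total progeny of a critical branching process is infinite. -/
theorem exists_rootSum_size_eq_top (H : IsCriticalKernel Q N₀ π) {a₀ : 𝒳}
    (h₀ : 0 < Q a₀ []) : ∃ a, rootSum (fun t => t.size * ewt Q t) a = ∞ := by
  by_contra! hne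
  set e := rootSum (fun t => t.size * ewt Q t) with he
  set r : 𝒳 → ℝ := fun a => (e a).toReal with hr
  have hr0 : ∀ a, 0 ≤ r a := fun a => ENNReal.toReal_nonneg
  have her : ∀ a, e a = ENNReal.ofReal (r a) := fun a => (ENNReal.ofReal_toReal (hne a)).symm
  have hsum : ∀ c : List 𝒳, (c.map e).sum = ENNReal.ofReal (c.map r).sum := fun c => by
    rw [funext her]
    induction c with
    | nil => simp
    | cons b c ih =>
      rw [List.map_cons, List.sum_cons, ih, List.map_cons, List.sum_cons,
        ENNReal.ofReal_add (hr0 b) (List.sum_nonneg (by simpa using fun a _ => hr0 a))]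
  have hsum0 : ∀ c : List 𝒳, 0 ≤ (c.map r).sum := fun c =>
    List.sum_nonneg (by simpa using fun a _ => hr0 a)
  have hrec : ∀ a, r a = 1 + ((gwA Q)ᵀ *ᵥ r) a := fun a => by
    have h := rootSum_size H.nonneg (H.rootSum_eq_one h₀) a
    rw [← he, tsum_eq_sum fun c hc => by
      rw [H.eq_zero_of_notMem hc, ENNReal.ofReal_zero, zero_mul]] at h
    simp only [hsum, ← ENNReal.ofReal_mul (H.nonneg _ _)] at h
    have h' : 0 ≤ ∑ c ∈ lists 𝒳 N₀, Q a c * (c.map r).sum :=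
      Finset.sum_nonneg fun c _ => mul_nonneg (H.nonneg a c) (hsum0 c)
    rw [← ENNReal.ofReal_sum_of_nonneg fun c _ => mul_nonneg (H.nonneg a c) (hsum0 c), her,
      ← ENNReal.ofReal_one, ← ENNReal.ofReal_add zero_le_one h',
      ENNReal.ofReal_eq_ofReal_iff (hr0 a) (by linarith)] at h
    rw [h, H.mean_sum]
  have h1 : π ⬝ᵥ r = π ⬝ᵥ (fun a => 1 + ((gwA Q)ᵀ *ᵥ r) a) := by rw [← funext hrec]
  have h2 : π ⬝ᵥ (fun a => 1 + ((gwA Q)ᵀ *ᵥ r) a) = 1 + π ⬝ᵥ ((gwA Q)ᵀ *ᵥ r) := by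
    simp only [dotProduct, mul_add, mul_one, Finset.sum_add_distrib, H.left_sum]
  rw [h2, H.left_dotProduct] at h1
  linarith

/-- Total weight of the trees with root type `a` and `n` vertices. -/
def mass (Q : 𝒳 → List 𝒳 → ℝ) (a : 𝒳) (n : ℕ) : ℝ≥0∞ :=
  rootSum (fun t => if t.size = n then ewt Q t else 0) a

theorem mass_le_one (H : IsCriticalKernel Q N₀ π) (a : 𝒳) (n : ℕ) : mass Q a n ≤ 1 := by
  refine (rootSum_mono (fun t => ?_) a).trans
    (rootSum_le_one H.nonneg (fun a => (H.tsum_ofReal a).le) a)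
  split_ifs <;> simp

theorem mass_ne_top (H : IsCriticalKernel Q N₀ π) (a : 𝒳) (n : ℕ) : mass Q a n ≠ ∞ :=
  ((H.mass_le_one a n).trans_lt ENNReal.one_lt_top).ne

omit [Fintype 𝒳] in
theorem rootSum_size_eq_tsum_mass (a : 𝒳) :
    rootSum (fun t => t.size * ewt Q t) a = ∑' n : ℕ, n * mass Q a n := by
  rw [rootSum, tsum_fiber size]
  refine tsum_congr fun n => ?_
  rw [mass, rootSum, ← ENNReal.tsum_mul_left]
  refine tsum_congr fun t => ?_
  by_cases h1 : t.size = n <;> by_cases h2 : t.root = a <;> simp [h1, h2]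

theorem exists_tree (H : IsCriticalKernel Q N₀ π) {a₀ : 𝒳} (h₀ : 0 < Q a₀ []) (a : 𝒳) :
    ∃ t : GWTree 𝒳, t.root = a ∧ ewt Q t ≠ 0 := by
  by_contra! hne
  have h1 := H.rootSum_eq_one h₀ a
  rw [rootSum, ENNReal.tsum_eq_zero.2 fun t => by
    split_ifs with h
    · exact hne t h
    · rfl] at h1
  exact zero_ne_one h1

/-- Up to a shift of the size and a constant, trees rooted at `a` are at least as
likely as trees rooted at `b`. -/
def Dominates (Q : 𝒳 → List 𝒳 → ℝ) (a b : 𝒳) : Prop :=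
  ∃ ℓ : ℕ, ∃ κ : ℝ≥0∞, κ ≠ 0 ∧ κ ≠ ∞ ∧ ∀ n, κ * mass Q b n ≤ mass Q a (n + ℓ)

omit [Fintype 𝒳] in
theorem Dominates.refl (a : 𝒳) : Dominates Q a a :=
  ⟨0, 1, one_ne_zero, ENNReal.one_ne_top, fun n => by simp⟩

omit [Fintype 𝒳] in
theorem Dominates.trans {a b c : 𝒳} (h₁ : Dominates Q a b) (h₂ : Dominates Q b c) :
    Dominates Q a c := by
  obtain ⟨ℓ, κ, hκ, hκ', h⟩ := h₁
  obtain ⟨ℓ', κ', hk, hk', h'⟩ := h₂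
  refine ⟨ℓ' + ℓ, κ * κ', mul_ne_zero hκ hk, ENNReal.mul_ne_top hκ' hk', fun n => ?_⟩
  rw [mul_assoc, ← add_assoc]
  exact (mul_le_mul_right (h' n) κ).trans (h _)

theorem list_prod_ne_zero {α : Type*} {f : α → ℝ≥0∞} (hf : ∀ x, f x ≠ 0) (l : List α) :
    (l.map f).prod ≠ 0 := by
  simp [hf]

theorem list_prod_ne_top {α : Type*} {f : α → ℝ≥0∞} (hf : ∀ x, f x ≠ ∞) (l : List α) :
    (l.map f).prod ≠ ∞ := by
  induction l with
  | nil => simp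
  | cons x l ih => simpa using ENNReal.mul_ne_top (hf x) ih

omit [DecidableEq 𝒳] [Fintype 𝒳] in
theorem ewt_ne_top (t : GWTree 𝒳) : ewt Q t ≠ ∞ := ENNReal.ofReal_ne_top

theorem dominates_of_mem (H : IsCriticalKernel Q N₀ π) {a₀ : 𝒳} (h₀ : 0 < Q a₀ []) {a b : 𝒳}
    {c : List 𝒳} (hc : 0 < Q a c) (hb : b ∈ c) : Dominates Q a b := by
  obtain ⟨l₁, l₂, rfl⟩ := List.append_of_mem hb
  choose T hT hT0 using H.exists_tree h₀
  set F : GWTree 𝒳 → GWTree 𝒳 := fun t => node a (l₁.map T ++ t :: l₂.map T) with hF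
  have hinj : Function.Injective F := fun t t' h => by simpa [hF] using h
  have hroot : ∀ l : List 𝒳, l.map (root ∘ T) = l := fun l => by
    rw [show root ∘ T = id from funext hT, List.map_id]
  refine ⟨1 + (l₁.map (size ∘ T)).sum + (l₂.map (size ∘ T)).sum,
    ENNReal.ofReal (Q a (l₁ ++ b :: l₂)) *
      ((l₁.map (ewt Q ∘ T)).prod * (l₂.map (ewt Q ∘ T)).prod), ?_, ?_, fun n => ?_⟩
  · refine mul_ne_zero (ENNReal.ofReal_pos.2 hc).ne' (mul_ne_zero ?_ ?_) <;>
    exact list_prod_ne_zero (fun x => hT0 x) _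
  · refine ENNReal.mul_ne_top ENNReal.ofReal_ne_top (ENNReal.mul_ne_top ?_ ?_) <;>
    exact list_prod_ne_top (fun x => ewt_ne_top _) _
  · rw [mass, mass, rootSum, rootSum, ← ENNReal.tsum_mul_left]
    refine le_trans (ENNReal.tsum_le_tsum fun t => ?_)
      (ENNReal.tsum_comp_le_tsum_of_injective hinj _)
    by_cases h1 : t.root = b
    · by_cases h2 : t.size = n
      · have h3 : (F t).root = a := rfl
        have h4 : (F t).size = n + (1 + (l₁.map (size ∘ T)).sum + (l₂.map (size ∘ T)).sum) := by
          simp only [hF, size_node, List.map_append, List.map_cons, List.map_map, List.sum_append,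
            List.sum_cons, h2]
          omega
        simp only [h1, h2, h3, h4, if_true]
        simp only [hF, ewt_node H.nonneg, List.map_append, List.map_cons, List.map_map, hroot, h1,
          List.prod_append, List.prod_cons]
        apply le_of_eq
        ring
      · simp [h2]
    · simp [h1]

theorem dominates (H : IsCriticalKernel Q N₀ π) {a₀ : 𝒳} (h₀ : 0 < Q a₀ []) (a b : 𝒳) :
    Dominates Q a b := by
  have key : ∀ k : ℕ, ∀ a b, (gwA Q ^ k) b a ≠ 0 → Dominates Q a b := by
    intro k
    induction k with
    | zero =>
      intro a b h
      rw [pow_zero, Matrix.one_apply] at h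
      have : b = a := by
        by_contra hne
        simp [hne] at h
      rw [this]
      exact Dominates.refl a
    | succ k ih =>
      intro a b h
      rw [pow_succ, Matrix.mul_apply] at h
      obtain ⟨d, -, hd⟩ := Finset.exists_ne_zero_of_sum_ne_zero h
      refine Dominates.trans ?_ (ih d b (left_ne_zero_of_mul hd))
      have h2 := right_ne_zero_of_mul hd
      rw [H.gwA_eq] at h2
      obtain ⟨c, -, hc⟩ := Finset.exists_ne_zero_of_sum_ne_zero h2
      refine H.dominates_of_mem h₀ (c := c)
        (lt_of_le_of_ne (H.nonneg _ _) (left_ne_zero_of_mul hc).symm) ?_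
      by_contra hmem
      exact right_ne_zero_of_mul hc (by simp [List.count_eq_zero_of_not_mem hmem])
  obtain ⟨k, -, hk⟩ := H.irr b a
  exact key k a b hk.ne.symm

/-- Two trees rooted at `a` can be grafted into one. -/
theorem exists_mass_supermul (H : IsCriticalKernel Q N₀ π) {a₀ : 𝒳} (h₀ : 0 < Q a₀ [])
    (a : 𝒳) : ∃ ℓ : ℕ, 0 < ℓ ∧ ∃ κ : ℝ≥0∞, κ ≠ 0 ∧ κ ≠ ∞ ∧
      ∀ n m, κ * (mass Q a n * mass Q a m) ≤ mass Q a (n + m + ℓ) := by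
  obtain ⟨a', b₁, b₂, l, hQ⟩ := H.exists_branching h₀
  choose T hT hT0 using H.exists_tree h₀
  have hroot : l.map (root ∘ T) = l := by
    rw [show root ∘ T = id from funext hT, List.map_id]
  set κ := ENNReal.ofReal (Q a' (b₁ :: b₂ :: l)) * (l.map (ewt Q ∘ T)).prod with hκ
  set ℓ := 1 + (l.map (size ∘ T)).sum with hℓ
  have key : ∀ n m, κ * (mass Q b₁ n * mass Q b₂ m) ≤ mass Q a' (n + m + ℓ) := by
    intro n m
    set F : GWTree 𝒳 × GWTree 𝒳 → GWTree 𝒳 := fun p => node a' (p.1 :: p.2 :: l.map T) with hF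
    have hinj : Function.Injective F := fun p p' h => by
      simp only [hF, node.injEq, List.cons.injEq, and_true, true_and] at h
      exact Prod.ext h.1 h.2
    rw [mass, mass, mass, rootSum, rootSum, rootSum, ← ENNReal.tsum_mul_right]
    simp only [← ENNReal.tsum_mul_left]
    rw [← ENNReal.tsum_prod]
    refine le_trans (ENNReal.tsum_le_tsum fun p => ?_)
      (ENNReal.tsum_comp_le_tsum_of_injective hinj _)
    obtain ⟨t, t'⟩ := p
    by_cases h : t.root = b₁ ∧ t.size = n ∧ t'.root = b₂ ∧ t'.size = m
    · obtain ⟨h1, h2, h3, h4⟩ := h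
      have h5 : (F (t, t')).root = a' := rfl
      have h6 : (F (t, t')).size = n + m + ℓ := by
        simp only [hF, size_node, List.map_cons, List.map_map, List.sum_cons, h2, h4, hℓ]
        omega
      simp only [h1, h2, h3, h4, h5, h6, if_true]
      simp only [hF, ewt_node H.nonneg, List.map_cons, List.map_map, hroot, h1, h3,
        List.prod_cons, hκ]
      apply le_of_eq
      ring
    · have : ((if t.root = b₁ then (if t.size = n then ewt Q t else 0) else 0) *
          (if t'.root = b₂ then (if t'.size = m then ewt Q t' else 0) else 0)) = 0 := by
        rw [mul_eq_zero]
        by_contra! hne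
        exact h ⟨by by_contra hh; simp [hh] at hne, by by_contra hh; simp [hh] at hne,
          by by_contra hh; simp [hh] at hne, by by_contra hh; simp [hh] at hne⟩
      simp [this]
  obtain ⟨ℓ₀, κ₀, hk₀, hk₀', d₀⟩ := H.dominates h₀ a a'
  obtain ⟨ℓ₁, κ₁, hk₁, hk₁', d₁⟩ := H.dominates h₀ b₁ a
  obtain ⟨ℓ₂, κ₂, hk₂, hk₂', d₂⟩ := H.dominates h₀ b₂ a
  refine ⟨ℓ₁ + ℓ₂ + ℓ + ℓ₀, by omega, κ₀ * (κ * (κ₁ * κ₂)), ?_, ?_, fun n m => ?_⟩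
  · refine mul_ne_zero hk₀ (mul_ne_zero (mul_ne_zero (ENNReal.ofReal_pos.2 hQ).ne' ?_)
      (mul_ne_zero hk₁ hk₂))
    exact list_prod_ne_zero (fun x => hT0 x) _
  · refine ENNReal.mul_ne_top hk₀' (ENNReal.mul_ne_top (ENNReal.mul_ne_top
      ENNReal.ofReal_ne_top ?_) (ENNReal.mul_ne_top hk₁' hk₂'))
    exact list_prod_ne_top (fun x => ewt_ne_top _) _
  · calc κ₀ * (κ * (κ₁ * κ₂)) * (mass Q a n * mass Q a m)
        = κ₀ * (κ * ((κ₁ * mass Q a n) * (κ₂ * mass Q a m))) := by ring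
      _ ≤ κ₀ * (κ * (mass Q b₁ (n + ℓ₁) * mass Q b₂ (m + ℓ₂))) := by
          gcongr
          · exact d₁ n
          · exact d₂ m
      _ ≤ κ₀ * mass Q a' ((n + ℓ₁) + (m + ℓ₂) + ℓ) := by
          gcongr
          exact key _ _
      _ ≤ mass Q a ((n + ℓ₁) + (m + ℓ₂) + ℓ + ℓ₀) := d₀ _
      _ = mass Q a (n + m + (ℓ₁ + ℓ₂ + ℓ + ℓ₀)) := by congr 1; omega

/-- The mass of trees with a given root type does not decay exponentially. -/
theorem not_exponential_decay (H : IsCriticalKernel Q N₀ π) {a₀ : 𝒳} (h₀ : 0 < Q a₀ [])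
    (b : 𝒳) {δ : ℝ} (hδ : 0 < δ) (C : ℝ) :
    ∃ n : ℕ, C * Real.exp (-δ * n) < (mass Q b n).toReal := by
  by_contra! hne
  obtain ⟨a, ha⟩ := H.exists_rootSum_size_eq_top h₀
  obtain ⟨ℓ, κ, hκ, hκ', hd⟩ := H.dominates h₀ b a
  have hκr : 0 < κ.toReal := ENNReal.toReal_pos hκ hκ'
  have hbound : ∀ n : ℕ, n * (mass Q a n).toReal ≤
      (κ.toReal)⁻¹ * |C| * (n ^ 1 * Real.exp (-δ * n)) := fun n => by
    have h1 : κ.toReal * (mass Q a n).toReal ≤ (mass Q b (n + ℓ)).toReal := by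
      rw [← ENNReal.toReal_mul]
      exact ENNReal.toReal_mono (H.mass_ne_top _ _) (hd n)
    have h2 : C * Real.exp (-δ * (n + ℓ : ℕ)) ≤ |C| * Real.exp (-δ * n) := by
      have : Real.exp (-δ * (n + ℓ : ℕ)) ≤ Real.exp (-δ * n) := by
        apply Real.exp_le_exp.2
        push_cast
        nlinarith [(Nat.cast_nonneg ℓ : (0 : ℝ) ≤ ℓ)]
      exact mul_le_mul (le_abs_self C) this (Real.exp_pos _).le (abs_nonneg C)
    have h3 : (mass Q a n).toReal ≤ (κ.toReal)⁻¹ * (|C| * Real.exp (-δ * n)) := by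
      rw [← div_eq_inv_mul, le_div_iff₀ hκr, mul_comm]
      exact h1.trans ((hne _).trans h2)
    calc n * (mass Q a n).toReal ≤ n * ((κ.toReal)⁻¹ * (|C| * Real.exp (-δ * n))) := by gcongr
      _ = _ := by ring
  have hsum : Summable fun n : ℕ => n * (mass Q a n).toReal :=
    Summable.of_nonneg_of_le (fun n => by positivity) hbound
      ((Real.summable_pow_mul_exp_neg_nat_mul 1 hδ).mul_left _)
  rw [rootSum_size_eq_tsum_mass] at ha
  refine hsum.tsum_ofReal_ne_top ?_
  rw [← ha]
  refine tsum_congr fun n => ?_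
  rw [ENNReal.ofReal_mul (Nat.cast_nonneg n), ENNReal.ofReal_natCast,
    ENNReal.ofReal_toReal (H.mass_ne_top a n)]

theorem exists_period (H : IsCriticalKernel Q N₀ π) {a₀ : 𝒳} (h₀ : 0 < Q a₀ []) (a : 𝒳)
    {δ : ℝ} (hδ : 0 < δ) : ∃ N : ℕ, 0 < N ∧ ∀ m,
      Real.exp (-δ * N) * (mass Q a m).toReal ≤ (mass Q a (m + N)).toReal := by
  obtain ⟨ℓ, hℓ, κ, hκ, hκ', hsup⟩ := H.exists_mass_supermul h₀ a
  have hκr : 0 < κ.toReal := ENNReal.toReal_pos hκ hκ'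
  obtain ⟨n, hn⟩ := H.not_exponential_decay h₀ a hδ ((κ.toReal)⁻¹ * Real.exp (-δ * ℓ))
  refine ⟨n + ℓ, by omega, fun m => ?_⟩
  have h1 : κ.toReal * ((mass Q a n).toReal * (mass Q a m).toReal) ≤
      (mass Q a (m + (n + ℓ))).toReal := by
    rw [← ENNReal.toReal_mul, ← ENNReal.toReal_mul, show m + (n + ℓ) = n + m + ℓ by omega]
    exact ENNReal.toReal_mono (H.mass_ne_top _ _) (hsup n m)
  have h2 : Real.exp (-δ * (n + ℓ : ℕ)) ≤ κ.toReal * (mass Q a n).toReal := by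
    have : Real.exp (-δ * (n + ℓ : ℕ)) = Real.exp (-δ * ℓ) * Real.exp (-δ * n) := by
      rw [← Real.exp_add]
      congr 1
      push_cast
      ring
    rw [this]
    rw [mul_assoc, ← div_eq_inv_mul, div_lt_iff₀ hκr] at hn
    linarith
  refine le_trans ?_ h1
  rw [← mul_assoc]
  exact mul_le_mul_of_nonneg_right h2 ENNReal.toReal_nonneg

theorem exp_mul_le_of_period {z : ℕ → ℝ} {δ : ℝ} {N : ℕ}
    (h : ∀ m, Real.exp (-δ * N) * z m ≤ z (m + N)) (k m : ℕ) :
    Real.exp (-δ * (k * N : ℕ)) * z m ≤ z (m + k * N) := by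
  induction k with
  | zero => simp
  | succ k ih =>
    have h1 := h (m + k * N)
    have h2 : Real.exp (-δ * ((k + 1) * N : ℕ)) =
        Real.exp (-δ * N) * Real.exp (-δ * (k * N : ℕ)) := by
      rw [← Real.exp_add]
      congr 1
      push_cast
      ring
    rw [h2, mul_assoc, show m + (k + 1) * N = m + k * N + N by ring]
    exact (mul_le_mul_of_nonneg_left ih (Real.exp_pos _).le).trans h1

theorem summable_wt (H : IsCriticalKernel Q N₀ π) : Summable (wt Q) :=
  GWTree.summable_wt H.nonneg fun a => (H.tsum_ofReal a).le

theorem Zn_eq (H : IsCriticalKernel Q N₀ π) (μ : 𝒳 → ℝ) (n : ℕ) :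
    Zn μ Q n = ∑ a, μ a * (mass Q a n).toReal := by
  have hs : ∀ a, Summable fun t : GWTree 𝒳 =>
      if t.root = a then if t.size = n then wt Q t else 0 else 0 := fun a =>
    Summable.of_nonneg_of_le
      (fun t => by split_ifs <;> first | exact wt_nonneg H.nonneg t | exact le_rfl)
      (fun t => by split_ifs <;> first | exact wt_nonneg H.nonneg t | exact le_rfl)
      H.summable_wt
  have hm : ∀ a, (mass Q a n).toReal =
      ∑' t : GWTree 𝒳, if t.root = a then if t.size = n then wt Q t else 0 else 0 := fun a => by
    rw [mass, rootSum, ENNReal.tsum_toReal_eq]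
    · refine tsum_congr fun t => ?_
      split_ifs
      · exact ENNReal.toReal_ofReal (wt_nonneg H.nonneg t)
      · rfl
      · rfl
    · intro t
      split_ifs
      · exact ewt_ne_top t
      · exact ENNReal.zero_ne_top
      · exact ENNReal.zero_ne_top
  simp only [hm, ← tsum_mul_left]
  rw [Zn, ← Summable.tsum_finsetSum fun a _ => (hs a).mul_left (μ a)]
  refine tsum_congr fun t => ?_
  rw [Finset.sum_eq_single t.root]
  · simp
  · intro b _ hb
    simp [Ne.symm hb]
  · simp

theorem exists_leaf {μ : 𝒳 → ℝ} (H : IsCriticalKernel Q N₀ π) (hZ : 0 < Zn μ Q 1) :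
    ∃ a, 0 < Q a [] := by
  by_contra! hne
  have hne' : ∀ a, Q a [] = 0 := fun a => le_antisymm (hne a) (H.nonneg a _)
  have hwt : ∀ t, wt Q t = 0 := fun t => by
    induction t using induction_on with
    | h a ts ih =>
      rw [wt_node]
      cases ts with
      | nil => simp [hne']
      | cons t ts => simp [ih t]
  simp [Zn, hwt] at hZ

/-- The partition function decays subexponentially. -/
theorem exists_Zn_lower_bound (H : IsCriticalKernel Q N₀ π) {μ : 𝒳 → ℝ} (hμ : ∀ a, 0 ≤ μ a)
    (hZ : ∀ n : ℕ, 1 ≤ n → 0 < Zn μ Q n) {δ : ℝ} (hδ : 0 < δ) :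
    ∃ c : ℝ, 0 < c ∧ ∀ n : ℕ, 1 ≤ n → c * Real.exp (-δ * n) ≤ Zn μ Q n := by
  obtain ⟨a₀, h₀⟩ := H.exists_leaf (hZ 1 le_rfl)
  choose P hP hper using fun a => H.exists_period h₀ a hδ
  set N := ∏ a, P a with hN
  have hNpos : 0 < N := Finset.prod_pos fun a _ => hP a
  have hmass : ∀ a m, Real.exp (-δ * N) * (mass Q a m).toReal ≤
      (mass Q a (m + N)).toReal := fun a m => by
    obtain ⟨k, hk⟩ : P a ∣ N := Finset.dvd_prod_of_mem P (Finset.mem_univ a)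
    rw [hk, mul_comm]
    have := exp_mul_le_of_period (hper a) k m
    rwa [mul_comm k, mul_comm] at this
  have hZper : ∀ m, Real.exp (-δ * N) * Zn μ Q m ≤ Zn μ Q (m + N) := fun m => by
    rw [H.Zn_eq, H.Zn_eq, Finset.mul_sum]
    refine Finset.sum_le_sum fun a _ => ?_
    rw [mul_left_comm]
    exact mul_le_mul_of_nonneg_left (hmass a m) (hμ a)
  obtain ⟨m₀, hm₀, hmin⟩ := Finset.exists_min_image (Finset.Icc 1 N) (Zn μ Q)
    ⟨1, Finset.mem_Icc.2 ⟨le_rfl, hNpos⟩⟩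
  refine ⟨Zn μ Q m₀, hZ _ (Finset.mem_Icc.1 hm₀).1, fun n hn => ?_⟩
  set m := (n - 1) % N + 1 with hm
  set k := (n - 1) / N with hk
  have hmk : m + k * N = n := by
    have := Nat.mod_add_div (n - 1) N
    rw [mul_comm, ← hk] at this
    omega
  have hmmem : m ∈ Finset.Icc 1 N :=
    Finset.mem_Icc.2 ⟨by omega, Nat.mod_lt _ hNpos⟩
  have h1 := exp_mul_le_of_period hZper k m
  rw [hmk] at h1
  refine le_trans ?_ h1
  rw [mul_comm]
  refine mul_le_mul ?_ (hmin m hmmem) (hZ _ (Finset.mem_Icc.1 hm₀).1).le (Real.exp_pos _).le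
  apply Real.exp_le_exp.2
  have : ((k * N : ℕ) : ℝ) ≤ n := by exact_mod_cast (hmk ▸ Nat.le_add_left _ _ : k * N ≤ n)
  nlinarith

omit [Fintype 𝒳] [DecidableEq 𝒳] in
theorem sum_map_data_node (G : 𝒳 × List 𝒳 → ℝ) (a : 𝒳) (ts : List (GWTree 𝒳)) :
    ((node a ts).data.map G).sum =
      G (a, ts.map root) + (ts.map fun t => (t.data.map G).sum).sum := by
  rw [data_node, List.map_cons, List.sum_cons, List.map_flatten, List.sum_flatten, List.map_map,
    List.map_map]
  rfl

omit [Fintype 𝒳] [DecidableEq 𝒳] in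
theorem length_data (t : GWTree 𝒳) : t.data.length = t.size := by
  induction t using induction_on with
  | h a ts ih =>
    rw [data_node, size_node, List.length_cons, List.length_flatten, List.map_map, add_comm]
    congr 2
    exact List.map_congr_left ih

omit [Fintype 𝒳] [DecidableEq 𝒳] in
/-- The coboundary of `h` telescopes along a tree. -/
theorem sum_data_coboundary (F : 𝒳 × List 𝒳 → ℝ) (h : 𝒳 → ℝ) (t : GWTree 𝒳) :
    (t.data.map fun x => F x - h x.1 + (x.2.map h).sum).sum = (t.data.map F).sum - h t.root := by
  induction t using induction_on with
  | h a ts ih =>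
    rw [sum_map_data_node, sum_map_data_node, List.map_congr_left ih, List.map_map]
    have : ∀ ts : List (GWTree 𝒳), (ts.map fun t => (t.data.map F).sum - h t.root).sum =
        (ts.map fun t => (t.data.map F).sum).sum - (ts.map (h ∘ root)).sum := fun ts => by
      induction ts with
      | nil => simp
      | cons t ts ih =>
        simp only [List.map_cons, List.sum_cons, ih, Function.comp]
        ring
    rw [this]
    simp only [root]
    ring

omit [Fintype 𝒳] [DecidableEq 𝒳] in
theorem wt_tilt (G : 𝒳 × List 𝒳 → ℝ) (t : GWTree 𝒳) :
    wt (fun a c => Q a c * Real.exp (G (a, c))) t = wt Q t * Real.exp (t.data.map G).sum := by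
  induction t using induction_on with
  | h a ts ih =>
    rw [wt_node, wt_node, sum_map_data_node, List.map_congr_left ih, Real.exp_add,
      List.prod_map_mul, Real.exp_list_sum, List.map_map]
    simp only [Function.comp_def]
    ring

/-- After correcting a centred functional by a coboundary, its exponential moments are
quadratically small uniformly in the type. -/
theorem exists_corrector (H : IsCriticalKernel Q N₀ π) {F : 𝒳 × List 𝒳 → ℝ}
    (hF : ∑ a, π a * ∑ c ∈ lists 𝒳 N₀, Q a c * F (a, c) = 0) :
    ∃ (h : 𝒳 → ℝ) (K : ℝ), 0 < K ∧ ∀ θ : ℝ, 0 ≤ θ → θ * K ≤ 1 → ∀ a,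
      ∑ c ∈ lists 𝒳 N₀, Q a c *
        Real.exp (θ * (F (a, c) - h a + (c.map h).sum) - (θ * K) ^ 2) ≤ 1 := by
  have : Nonempty 𝒳 := by
    by_contra hne
    rw [not_nonempty_iff] at hne
    have := H.left_sum
    simp at this
  obtain ⟨h, hh⟩ := Matrix.exists_poisson_solution H.gwA_nonneg H.irr H.left_pos H.mulVec_left
    (g := fun a => ∑ c ∈ lists 𝒳 N₀, Q a c * F (a, c)) hF
  set D : 𝒳 → List 𝒳 → ℝ := fun a c => F (a, c) - h a + (c.map h).sum with hD
  have hmean : ∀ a, ∑ c ∈ lists 𝒳 N₀, Q a c * D a c = 0 := fun a => by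
    have h1 := congrFun hh a
    simp only [Pi.sub_apply] at h1
    simp only [hD, mul_add, mul_sub, Finset.sum_add_distrib, Finset.sum_sub_distrib,
      H.mean_sum, ← Finset.sum_mul, H.sum_one]
    linarith
  set K : ℝ := 1 + ∑ a, ∑ c ∈ lists 𝒳 N₀, |D a c| with hK
  have hKpos : 0 < K := by positivity
  have hDK : ∀ a, ∀ c ∈ lists 𝒳 N₀, |D a c| ≤ K := fun a c hc => by
    have h1 := Finset.single_le_sum (f := fun c => |D a c|) (fun c _ => abs_nonneg _) hc
    have h2 := Finset.single_le_sum (f := fun a => ∑ c ∈ lists 𝒳 N₀, |D a c|)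
      (fun a _ => Finset.sum_nonneg fun c _ => abs_nonneg _) (Finset.mem_univ a)
    linarith
  refine ⟨h, K, hKpos, fun θ hθ hθK a => ?_⟩
  have hexp : ∀ c ∈ lists 𝒳 N₀,
      Real.exp (θ * D a c) ≤ 1 + θ * D a c + (θ * K) ^ 2 := fun c hc => by
    have h1 : |θ * D a c| ≤ θ * K := by
      rw [abs_mul, abs_of_nonneg hθ]
      exact mul_le_mul_of_nonneg_left (hDK a c hc) hθ
    have h2 := (abs_le.1 (Real.abs_exp_sub_one_sub_id_le (h1.trans hθK))).2
    have h3 : (θ * D a c) ^ 2 ≤ (θ * K) ^ 2 := sq_le_sq' (abs_le.1 h1).1 (abs_le.1 h1).2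
    linarith
  calc ∑ c ∈ lists 𝒳 N₀, Q a c * Real.exp (θ * D a c - (θ * K) ^ 2)
      = (∑ c ∈ lists 𝒳 N₀, Q a c * Real.exp (θ * D a c)) * Real.exp (-(θ * K) ^ 2) := by
        rw [Finset.sum_mul]
        refine Finset.sum_congr rfl fun c _ => ?_
        rw [sub_eq_add_neg, Real.exp_add, mul_assoc]
    _ ≤ (∑ c ∈ lists 𝒳 N₀, Q a c * (1 + θ * D a c + (θ * K) ^ 2)) *
          Real.exp (-(θ * K) ^ 2) := by
        refine mul_le_mul_of_nonneg_right (Finset.sum_le_sum fun c hc => ?_) (Real.exp_pos _).le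
        exact mul_le_mul_of_nonneg_left (hexp c hc) (H.nonneg a c)
    _ = (1 + (θ * K) ^ 2) * Real.exp (-(θ * K) ^ 2) := by
        congr 1
        have : ∀ c, Q a c * (1 + θ * D a c + (θ * K) ^ 2) =
            Q a c * (1 + (θ * K) ^ 2) + θ * (Q a c * D a c) := fun c => by ring
        simp only [this, Finset.sum_add_distrib, ← Finset.sum_mul, ← Finset.mul_sum, hmean,
          H.sum_one]
        ring
    _ ≤ Real.exp ((θ * K) ^ 2) * Real.exp (-(θ * K) ^ 2) := by
        gcongr
        linarith [Real.add_one_le_exp ((θ * K) ^ 2)]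
    _ = 1 := by rw [← Real.exp_add, add_neg_cancel, Real.exp_zero]

open Classical in
/-- Unconditional exponential bound for deviations of additive functionals. -/
theorem exists_deviation_bound (H : IsCriticalKernel Q N₀ π) {μ : 𝒳 → ℝ}
    (hμ : ∀ a, 0 ≤ μ a) (hμ1 : ∀ a, μ a ≤ 1) {F : 𝒳 × List 𝒳 → ℝ}
    (hF : ∑ a, π a * ∑ c ∈ lists 𝒳 N₀, Q a c * F (a, c) = 0) {ε : ℝ} (hε : 0 < ε) :
    ∃ C η : ℝ, 0 < η ∧ ∀ n : ℕ,
      (∑' t : GWTree 𝒳, if t.size = n ∧ t ∈ {t | ε * t.size ≤ (t.data.map F).sum} then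
        μ t.root * wt Q t else 0) ≤ C * Real.exp (-η * n) := by
  obtain ⟨h, K, hK, htilt⟩ := H.exists_corrector hF
  set θ := min (1 / K) (ε / (2 * K ^ 2)) with hθ
  have hθ0 : 0 < θ := lt_min (by positivity) (by positivity)
  have hθK : θ * K ≤ 1 := by
    rw [← le_div_iff₀ hK]
    exact min_le_left _ _
  have hθε : (θ * K) ^ 2 ≤ θ * ε / 2 := by
    have h1 : θ * (2 * K ^ 2) ≤ ε := by
      rw [← le_div_iff₀ (by positivity)]
      exact min_le_right _ _
    nlinarith
  set G : 𝒳 × List 𝒳 → ℝ :=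
    fun x => θ * (F x - h x.1 + (x.2.map h).sum) - (θ * K) ^ 2 with hG
  set Q' : 𝒳 → List 𝒳 → ℝ := fun a c => Q a c * Real.exp (G (a, c)) with hQ'
  have hQ'0 : ∀ a c, 0 ≤ Q' a c := fun a c => mul_nonneg (H.nonneg a c) (Real.exp_pos _).le
  have hQ'1 : ∀ a, ∑' c, ENNReal.ofReal (Q' a c) ≤ 1 := fun a => by
    rw [tsum_eq_sum fun c hc => by
      simp only [hQ', H.eq_zero_of_notMem hc, zero_mul, ENNReal.ofReal_zero]]
    rw [← ENNReal.ofReal_sum_of_nonneg fun c _ => hQ'0 a c, ENNReal.ofReal_le_one]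
    exact htilt θ hθ0.le hθK a
  have hGsum : ∀ t : GWTree 𝒳, (t.data.map G).sum =
      θ * ((t.data.map F).sum - h t.root) - (θ * K) ^ 2 * t.size := fun t => by
    rw [← sum_data_coboundary F h t, ← length_data]
    induction t.data with
    | nil => simp
    | cons x l ih =>
      rw [List.map_cons, List.sum_cons, ih, List.map_cons, List.sum_cons, List.length_cons]
      simp only [hG]
      push_cast
      ring
  set M := ∑ a, |h a| with hM
  have hhM : ∀ a, h a ≤ M := fun a => (le_abs_self _).trans
    (Finset.single_le_sum (f := fun a => |h a|) (fun a _ => abs_nonneg _) (Finset.mem_univ a))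
  refine ⟨Fintype.card 𝒳 * Real.exp (θ * M), θ * ε / 2, by positivity, fun n => ?_⟩
  have hsum' := GWTree.summable_wt hQ'0 hQ'1
  set B := Real.exp (θ * M) * Real.exp (-(θ * ε / 2) * n) with hB
  have hBpos : 0 < B := by positivity
  have hterm : ∀ t : GWTree 𝒳,
      (if t.size = n ∧ t ∈ {t | ε * t.size ≤ (t.data.map F).sum} then
        μ t.root * wt Q t else 0) ≤ wt Q' t * B := fun t => by
    split_ifs with ht
    · obtain ⟨rfl, ht⟩ := ht
      simp only [Set.mem_ofPred_eq] at ht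
      have h1 : μ t.root * wt Q t ≤ wt Q t :=
        mul_le_of_le_one_left (wt_nonneg H.nonneg t) (hμ1 _)
      refine h1.trans ?_
      rw [hQ', wt_tilt, mul_assoc, hB, ← Real.exp_add, ← Real.exp_add]
      refine le_mul_of_one_le_right (wt_nonneg H.nonneg t) (Real.one_le_exp ?_)
      rw [hGsum]
      have h2 := mul_le_mul_of_nonneg_left ht hθ0.le
      have h3 := mul_le_mul_of_nonneg_left (hhM t.root) hθ0.le
      have h4 := mul_le_mul_of_nonneg_right hθε (Nat.cast_nonneg t.size : (0 : ℝ) ≤ t.size)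
      linarith
    · exact mul_nonneg (wt_nonneg hQ'0 t) hBpos.le
  have hterm0 : ∀ t : GWTree 𝒳,
      0 ≤ (if t.size = n ∧ t ∈ {t | ε * t.size ≤ (t.data.map F).sum} then
        μ t.root * wt Q t else 0) := fun t => by
    split_ifs
    · exact mul_nonneg (hμ _) (wt_nonneg H.nonneg t)
    · exact le_rfl
  have hs := hsum'.mul_right B
  refine ((Summable.of_nonneg_of_le hterm0 hterm hs).tsum_le_tsum hterm hs).trans ?_
  rw [tsum_mul_right, hB, mul_assoc]
  exact mul_le_mul_of_nonneg_right (tsum_wt_le_card hQ'0 hQ'1) hBpos.le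

theorem condPr_nonneg (H : IsCriticalKernel Q N₀ π) {μ : 𝒳 → ℝ} (hμ : ∀ a, 0 ≤ μ a) (n : ℕ)
    (S : Set (GWTree 𝒳)) : 0 ≤ condPr μ Q n S := by
  refine div_nonneg (tsum_nonneg fun t => ?_) (tsum_nonneg fun t => ?_) <;> split_ifs <;>
    first | exact mul_nonneg (hμ _) (wt_nonneg H.nonneg t) | exact le_rfl

theorem condPr_le_sum (H : IsCriticalKernel Q N₀ π) {μ : 𝒳 → ℝ} (hμ : ∀ a, 0 ≤ μ a)
    (hμ1 : ∀ a, μ a ≤ 1) {n : ℕ} (hn : 0 < Zn μ Q n) {ι : Type*} (s : Finset ι)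
    {S : Set (GWTree 𝒳)} {T : ι → Set (GWTree 𝒳)}
    (hST : ∀ t ∈ S, t.size = n → ∃ i ∈ s, t ∈ T i) :
    condPr μ Q n S ≤ ∑ i ∈ s, condPr μ Q n (T i) := by
  classical
  have hw : ∀ t : GWTree 𝒳, 0 ≤ μ t.root * wt Q t := fun t =>
    mul_nonneg (hμ _) (wt_nonneg H.nonneg t)
  have h0 : ∀ (U : Set (GWTree 𝒳)) (t : GWTree 𝒳),
      0 ≤ if t.size = n ∧ t ∈ U then μ t.root * wt Q t else 0 := fun U t => by
    split_ifs
    · exact hw t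
    · exact le_rfl
  have hs : ∀ U : Set (GWTree 𝒳), Summable fun t : GWTree 𝒳 =>
      if t.size = n ∧ t ∈ U then μ t.root * wt Q t else 0 := fun U =>
    Summable.of_nonneg_of_le (h0 U) (fun t => by
      split_ifs
      · exact mul_le_of_le_one_left (wt_nonneg H.nonneg t) (hμ1 _)
      · exact wt_nonneg H.nonneg t) H.summable_wt
  simp only [condPr]
  rw [← Finset.sum_div]
  refine div_le_div_of_nonneg_right ?_ hn.le
  rw [← Summable.tsum_finsetSum fun i _ => hs (T i)]
  refine (hs S).tsum_le_tsum (fun t => ?_) (summable_sum fun i _ => hs (T i))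
  by_cases ht : t.size = n ∧ t ∈ S
  · obtain ⟨i, hi, hti⟩ := hST t ht.2 ht.1
    refine le_trans (le_of_eq ?_) (Finset.single_le_sum (fun i _ => h0 (T i) t) hi)
    simp [ht.1, ht.2, hti]
  · rw [if_neg ht]
    exact Finset.sum_nonneg fun i _ => h0 (T i) t

theorem tendsto_condPr_deviation (H : IsCriticalKernel Q N₀ π) {μ : 𝒳 → ℝ}
    (hμ : ∀ a, 0 ≤ μ a) (hμ1 : ∀ a, μ a ≤ 1) (hZ : ∀ n : ℕ, 1 ≤ n → 0 < Zn μ Q n)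
    {F : 𝒳 × List 𝒳 → ℝ}
    (hF : ∑ a, π a * ∑ c ∈ lists 𝒳 N₀, Q a c * F (a, c) = 0) {ε : ℝ} (hε : 0 < ε) :
    Tendsto (fun n => condPr μ Q n {t | ε * t.size ≤ (t.data.map F).sum}) atTop (nhds 0) := by
  obtain ⟨C, η, hη, hnum⟩ := H.exists_deviation_bound hμ hμ1 hF hε
  obtain ⟨c, hc, hden⟩ := H.exists_Zn_lower_bound hμ hZ (half_pos hη)
  have hlim : Tendsto (fun n : ℕ => |C| / c * Real.exp (-(η / 2) * n)) atTop (nhds 0) := by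
    have : Tendsto (fun n : ℕ => Real.exp (-(η / 2) * n)) atTop (nhds 0) := by
      refine Real.tendsto_exp_atBot.comp ?_
      exact tendsto_natCast_atTop_atTop.const_mul_atTop_of_neg (by linarith)
    simpa using this.const_mul (|C| / c)
  refine tendsto_of_tendsto_of_tendsto_of_le_of_le' tendsto_const_nhds hlim
    (Eventually.of_forall fun n => H.condPr_nonneg hμ n _) ?_
  filter_upwards [eventually_ge_atTop 1] with n hn
  rw [condPr, div_le_iff₀ (hZ n hn)]
  calc _ ≤ C * Real.exp (-η * n) := hnum n
    _ ≤ |C| * Real.exp (-η * n) :=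
        mul_le_mul_of_nonneg_right (le_abs_self C) (Real.exp_pos _).le
    _ = |C| / c * Real.exp (-(η / 2) * n) * (c * Real.exp (-(η / 2) * n)) := by
        rw [show -η * (n : ℝ) = -(η / 2) * n + -(η / 2) * n by ring, Real.exp_add]
        field_simp
    _ ≤ _ := mul_le_mul_of_nonneg_left (hden n hn) (by positivity)

/-- Signed centred indicator of the offspring configuration `x`. -/
def centredIndicator (p σ : ℝ) (x y : 𝒳 × List 𝒳) : ℝ := σ * ((if y = x then 1 else 0) - p)

omit [Fintype 𝒳] in
theorem sum_data_centredIndicator (p σ : ℝ) (x : 𝒳 × List 𝒳) (t : GWTree 𝒳) :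
    (t.data.map (centredIndicator p σ x)).sum = σ * (empOff t x - p) * t.size := by
  have h : ∀ l : List (𝒳 × List 𝒳), (l.map (centredIndicator p σ x)).sum =
      σ * (l.count x - p * l.length) := fun l => by
    induction l with
    | nil => simp
    | cons y l ih =>
      simp only [List.map_cons, List.sum_cons, ih, List.count_cons, List.length_cons,
        centredIndicator, beq_iff_eq]
      push_cast
      ring
  have hs : (t.size : ℝ) ≠ 0 := by exact_mod_cast t.size_pos.ne'
  rw [h, length_data, empOff]
  field_simp

theorem centredIndicator_mean (H : IsCriticalKernel Q N₀ π) (σ : ℝ) (a₀ : 𝒳) {c₀ : List 𝒳}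
    (hc₀ : c₀ ∈ lists 𝒳 N₀) :
    ∑ a, π a * ∑ c ∈ lists 𝒳 N₀,
      Q a c * centredIndicator (π a₀ * Q a₀ c₀) σ (a₀, c₀) (a, c) = 0 := by
  have h1 : ∀ a, ∑ c ∈ lists 𝒳 N₀,
      Q a c * centredIndicator (π a₀ * Q a₀ c₀) σ (a₀, c₀) (a, c) =
        σ * (if a = a₀ then Q a₀ c₀ else 0) - σ * (π a₀ * Q a₀ c₀) := fun a => by
    have : ∀ c, Q a c * centredIndicator (π a₀ * Q a₀ c₀) σ (a₀, c₀) (a, c) =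
        σ * (if c = c₀ then (if a = a₀ then Q a₀ c₀ else 0) else 0) -
          Q a c * (σ * (π a₀ * Q a₀ c₀)) := fun c => by
      by_cases h : a = a₀ <;> by_cases h' : c = c₀ <;> simp [centredIndicator, h, h'] <;> ring
    simp only [this, Finset.sum_sub_distrib, ← Finset.mul_sum, ← Finset.sum_mul, H.sum_one,
      Finset.sum_ite_eq', hc₀, if_true, one_mul]
  simp only [h1, mul_sub, Finset.sum_sub_distrib, ← Finset.sum_mul, H.left_sum]
  simp
  ring

end IsCriticalKernel

/-- **Weak law of large numbers for the empirical offspring measure** (Lemma 3.10).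
If `X` is an irreducible critical multitype Galton–Watson tree with bounded offspring kernel
`Q` (bounded by `N₀`), conditioned to have exactly `n` vertices, then for every `ε > 0`,
`ℙ_n{ max_{(a,c) ∈ 𝒳 × 𝒳₀*} |M_X(a,c) − π(a) Q(c|a)| ≥ ε } → 0`, where
`𝒳₀* = ⋃_{k ≤ N₀} {k} × 𝒳^k` (the maximum being `≥ ε` iff some coordinate is). -/
theorem wlln_empirical_offspring_measure
    {𝒳 : Type} [Fintype 𝒳] [DecidableEq 𝒳] [Nonempty 𝒳]
    (μ : 𝒳 → ℝ) (hμ0 : ∀ a, 0 ≤ μ a) (hμ1 : ∑ a, μ a = 1)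
    (Q : 𝒳 → List 𝒳 → ℝ) (hQ0 : ∀ a c, 0 ≤ Q a c) (hQ1 : ∀ a, ∑' c : List 𝒳, Q a c = 1)
    (N₀ : ℕ) (hbdd : ∀ a (c : List 𝒳), N₀ < c.length → Q a c = 0)
    (hirr : ∀ a b, ∃ k : ℕ, 0 < k ∧ 0 < (gwA Q ^ k) a b)
    (π : 𝒳 → ℝ) (hπ0 : ∀ a, 0 ≤ π a) (hπ1 : ∑ a, π a = 1)
    (hcrit : ∀ a, ∑ b, gwA Q a b * π b = π a)
    (hZ : ∀ n : ℕ, 1 ≤ n → 0 < Zn μ Q n) :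
    ∀ ε > 0, Filter.Tendsto (fun n : ℕ => condPr μ Q n
      {t : GWTree 𝒳 | ∃ a : 𝒳, ∃ c : List 𝒳, c.length ≤ N₀ ∧
        ε ≤ |empOff t (a, c) - π a * Q a c|})
      Filter.atTop (nhds 0) := by
  intro ε hε
  have H : IsCriticalKernel Q N₀ π := ⟨hQ0, hQ1, hbdd, hirr, hπ0, hπ1, hcrit⟩
  have hμ' : ∀ a, μ a ≤ 1 := fun a => by
    rw [← hμ1]
    exact Finset.single_le_sum (fun a _ => hμ0 a) (Finset.mem_univ a)
  set s : Finset ((𝒳 × List 𝒳) × ℝ) :=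
    (Finset.univ ×ˢ IsCriticalKernel.lists 𝒳 N₀) ×ˢ {1, -1} with hs
  set T : (𝒳 × List 𝒳) × ℝ → Set (GWTree 𝒳) := fun i => {t | ε * t.size ≤ (t.data.map
    (IsCriticalKernel.centredIndicator (π i.1.1 * Q i.1.1 i.1.2) i.2 i.1)).sum} with hT
  have hlim : Tendsto (fun n => ∑ i ∈ s, condPr μ Q n (T i)) atTop (nhds 0) := by
    rw [← Finset.sum_const_zero (s := s)]
    refine tendsto_finsetSum s fun i hi => ?_
    simp only [hs, Finset.mem_product, Finset.mem_univ, true_and] at hi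
    exact H.tendsto_condPr_deviation hμ0 hμ' hZ (H.centredIndicator_mean i.2 i.1.1 hi.1) hε
  refine tendsto_of_tendsto_of_tendsto_of_le_of_le' tendsto_const_nhds hlim
    (Eventually.of_forall fun n => H.condPr_nonneg hμ0 n _) ?_
  filter_upwards [eventually_ge_atTop 1] with n hn
  refine H.condPr_le_sum hμ0 hμ' (hZ n hn) s fun t ht _ => ?_
  obtain ⟨a, c, hc, hdev⟩ := ht
  have hmem : ∀ σ ∈ ({1, -1} : Finset ℝ), ((a, c), σ) ∈ s := fun σ hσ => by
    simp only [hs, Finset.mem_product, Finset.mem_univ, true_and]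
    exact ⟨IsCriticalKernel.mem_lists.2 hc, hσ⟩
  have hT' : ∀ σ : ℝ, ε ≤ σ * (empOff t (a, c) - π a * Q a c) → t ∈ T ((a, c), σ) :=
    fun σ h => by
      simp only [hT, Set.mem_ofPred_eq, IsCriticalKernel.sum_data_centredIndicator]
      exact mul_le_mul_of_nonneg_right h (Nat.cast_nonneg _)
  rcases le_abs.1 hdev with h | h
  · exact ⟨_, hmem 1 (by simp), hT' 1 (by linarith)⟩
  · exact ⟨_, hmem (-1) (by simp), hT' (-1) (by linarith)⟩
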